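/- arXiv:2501.14474 — 2 statements merged into one kernel-verified Lean document; each statement's English description precedes it below -/
import Mathlib

section
/- There is an absolute constant A > 0 such that for every 0 < ε ≤ 1 and all n, m, r, the class L_ε of ε-discrete linear contracts satisfies PDim(L_ε) ≤ min( log₂(⌈1/ε⌉ + 1), A·log₂(n + 1) ); in particular PDim(L_ε) = O(min(log n, log(1/ε))). -/
open scoped BigOperators

/-- An agent type in the hidden-action principal-agent model with `n` actions and
`m` outcomes: a production function `f` (a distribution over outcomes for each action)
and a nonnegative cost vector `c` with `c 0 = 0`. -/
structure AgentType (n m : ℕ) where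
  f : Fin n → Fin m → ℝ
  c : Fin n → ℝ
  f_nonneg : ∀ i j, 0 ≤ f i j
  f_sum : ∀ i, ∑ j, f i j = 1
  c_nonneg : ∀ i, 0 ≤ c i
  c_zero : ∀ i : Fin n, (i : ℕ) = 0 → c i = 0

/-- The agent's expected utility for action `i` under contract `t`. -/
def uA {n m : ℕ} (θ : AgentType n m) (t : Fin m → ℝ) (i : Fin n) : ℝ :=
  (∑ j, θ.f i j * t j) - θ.c i

/-- The principal's expected utility when the agent takes action `i` under contract `t`,
with rewards `r`. -/
def uPa {n m : ℕ} (r : Fin m → ℝ) (θ : AgentType n m) (t : Fin m → ℝ) (i : Fin n) : ℝ :=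
  ∑ j, θ.f i j * (r j - t j)

/-- The set of the agent's best-response actions to contract `t`. -/
def BestResp {n m : ℕ} (θ : AgentType n m) (t : Fin m → ℝ) : Set (Fin n) :=
  {i | ∀ i', uA θ t i' ≤ uA θ t i}

/-- The principal's utility under contract `t`: the agent best-responds, breaking ties
in favor of the principal. -/
noncomputable def uP {n m : ℕ} (r : Fin m → ℝ) (θ : AgentType n m) (t : Fin m → ℝ) : ℝ :=
  sSup (uPa r θ t '' BestResp θ t)

/-- The class of linear contracts `α • r`, `α ∈ [0,1]`. -/
def Clinear {m : ℕ} (r : Fin m → ℝ) : Set (Fin m → ℝ) :=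
  {t | ∃ α : ℝ, α ∈ Set.Icc (0:ℝ) 1 ∧ t = fun j => α * r j}

/-- The class of bounded contracts `[0,1]^m`. -/
def Cbounded (m : ℕ) : Set (Fin m → ℝ) := {t | ∀ j, t j ∈ Set.Icc (0:ℝ) 1}

/-- The class of unbounded contracts `ℝ_{≥0}^m`. -/
def Cunbounded (m : ℕ) : Set (Fin m → ℝ) := {t | ∀ j, 0 ≤ t j}

/-- A finitely supported probability distribution. -/
structure FinDist (α : Type*) where
  p : α → ℝ
  nonneg : ∀ a, 0 ≤ p a
  finite_support : (Function.support p).Finite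
  total : ∑ᶠ a, p a = 1

/-- Expectation of `g` under a finitely supported distribution `D`. -/
noncomputable def expect {α : Type*} (D : FinDist α) (g : α → ℝ) : ℝ :=
  ∑ᶠ a, D.p a * g a

/-- `OPT(C, D)`: the supremum over contracts in `C` of the principal's expected utility. -/
noncomputable def OPT {n m : ℕ} (C : Set (Fin m → ℝ)) (r : Fin m → ℝ)
    (D : FinDist (AgentType n m)) : ℝ :=
  sSup ((fun t => expect D (fun θ => uP r θ t)) '' C)

/-- Pseudo-dimension shattering: `C` shatters some `k` types in `Θ`. -/
def Shatters {n m : ℕ} (r : Fin m → ℝ) (C : Set (Fin m → ℝ))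
    (Θ : Set (AgentType n m)) (k : ℕ) : Prop :=
  ∃ θ : Fin k → AgentType n m, (∀ j, θ j ∈ Θ) ∧ ∃ τ : Fin k → ℝ,
    ∀ S : Finset (Fin k), ∃ t ∈ C,
      (∀ j, j ∈ S → τ j ≤ uP r (θ j) t) ∧ (∀ j, j ∉ S → uP r (θ j) t < τ j)

/-- `Cbar` is an `ε`-approximation of `C` (representation error at most `ε`). -/
def IsApprox (n : ℕ) {m : ℕ} (r : Fin m → ℝ) (Cbar C : Set (Fin m → ℝ)) (ε : ℝ) : Prop :=
  ∀ D : FinDist (AgentType n m), OPT Cbar r D ≥ OPT C r D - ε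

/-- Best responses breaking ties in favor of the principal. -/
def BestRespP {n m : ℕ} (r : Fin m → ℝ) (θ : AgentType n m) (t : Fin m → ℝ) : Set (Fin n) :=
  {i | i ∈ BestResp θ t ∧ ∀ i' ∈ BestResp θ t, uPa r θ t i' ≤ uPa r θ t i}

/-- Principal's expected reward under the linear contract `α • r`. -/
noncomputable def rP {n m : ℕ} (r : Fin m → ℝ) (θ : AgentType n m) (α : ℝ) : ℝ :=
  sSup ((fun i => ∑ j, θ.f i j * r j) '' BestRespP r θ (fun j => α * r j))

/-- The set of critical values of an agent type for linear contracts. -/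
def CritSet {n m : ℕ} (r : Fin m → ℝ) (θ : AgentType n m) : Set ℝ :=
  {α | α ∈ Set.Ioc (0:ℝ) 1 ∧ ∀ ε : ℝ, 0 < ε → ε ≤ α → rP r θ (α - ε) ≠ rP r θ α}

/-- Probability of the event `E` under `N` i.i.d. samples from `D`. -/
noncomputable def prodProb {α : Type*} (D : FinDist α) (N : ℕ) (E : Set (Fin N → α)) : ℝ :=
  ∑ᶠ s ∈ E, ∏ i, D.p (s i)

/-- The class of `ε`-discrete linear contracts. -/
def Leps {m : ℕ} (r : Fin m → ℝ) (ε : ℝ) : Set (Fin m → ℝ) :=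
  {t | ∃ α : ℝ, ((∃ k : ℕ, α = k * ε ∧ k * ε ≤ 1) ∨ α = 1) ∧ t = fun j => α * r j}

/-- The points lying strictly above an order-connected set form an upper set. -/
theorem Set.OrdConnected.isUpperSet_setOf_strictly_above {s : Set ℝ} (hs : s.OrdConnected) :
    IsUpperSet {x : ℝ | (∃ y ∈ s, y ≤ x) ∧ x ∉ s} := by
  rintro x z hxz ⟨⟨y, hy, hyx⟩, hx⟩
  exact ⟨⟨y, hy, hyx.trans hxz⟩, fun hz => hx (hs.out hy hz ⟨hyx, hxz⟩)⟩

/-- A family of upper sets of reals indexed by `κ` distinguishes at most `card κ + 1` points. -/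
theorem card_le_of_upperSets_separate {σ κ : Type*} [Fintype σ] [Fintype κ]
    (W : κ → Set ℝ) (hW : ∀ q, IsUpperSet (W q)) (x : σ → ℝ)
    (hx : ∀ a b, (∀ q, x a ∈ W q ↔ x b ∈ W q) → a = b) :
    Fintype.card σ ≤ Fintype.card κ + 1 := by
  classical
  let F : ℝ → Finset κ := fun z => Finset.univ.filter fun q => z ∈ W q
  have hmono : Monotone F := fun y z hyz q hq => by
    simp only [F, Finset.mem_filter, Finset.mem_univ, true_and] at hq ⊢
    exact hW q hyz hq
  have hF : ∀ y z, (F y).card = (F z).card → F y = F z := fun y z h => by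
    rcases le_total y z with hyz | hzy
    · exact Finset.eq_of_subset_of_card_le (hmono hyz) h.ge
    · exact (Finset.eq_of_subset_of_card_le (hmono hzy) h.le).symm
  let N : σ → Fin (Fintype.card κ + 1) := fun a =>
    ⟨(F (x a)).card, Nat.lt_succ_of_le (Finset.card_le_univ _)⟩
  have hN : Function.Injective N := fun a b hab => by
    have h := hF _ _ (congrArg Fin.val hab)
    refine hx a b fun q => ?_
    have hq := Finset.ext_iff.mp h q
    simpa only [F, Finset.mem_filter, Finset.mem_univ, true_and] using hq
  simpa using Fintype.card_le_of_injective N hN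

/-- If every subset of `ι` is cut out at some point of the line by sets that are unions of
`card κ` intervals, then `2 ^ card ι ≤ 2 * (card ι * card κ) + 1`. -/
theorem two_pow_card_le_of_intervals_shatter {ι κ : Type*} [Fintype ι] [Fintype κ]
    (I : ι → κ → Set ℝ) (hI : ∀ j i, (I j i).OrdConnected) (x : Finset ι → ℝ)
    (hx : ∀ S j, j ∈ S ↔ ∃ i, x S ∈ I j i) :
    2 ^ Fintype.card ι ≤ 2 * (Fintype.card ι * Fintype.card κ) + 1 := by
  classical
  let W : (ι × κ) ⊕ (ι × κ) → Set ℝ := Sum.elim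
    (fun p => {z | ∃ y ∈ I p.1 p.2, y ≤ z})
    (fun p => {z | (∃ y ∈ I p.1 p.2, y ≤ z) ∧ z ∉ I p.1 p.2})
  have hW : ∀ q, IsUpperSet (W q) := by
    rintro (p | p)
    · rintro a b hab ⟨y, hy, hya⟩
      exact ⟨y, hy, hya.trans hab⟩
    · exact (hI p.1 p.2).isUpperSet_setOf_strictly_above
  have hmem : ∀ z j i, z ∈ I j i ↔ z ∈ W (.inl (j, i)) ∧ z ∉ W (.inr (j, i)) := fun z j i => by
    simp only [W, Sum.elim_inl, Sum.elim_inr, Set.mem_ofPred_eq]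
    exact ⟨fun h => ⟨⟨z, h, le_rfl⟩, fun h' => h'.2 h⟩,
      fun h => by_contra fun h' => h.2 ⟨h.1, h'⟩⟩
  have h := card_le_of_upperSets_separate W hW x fun S T hST => by
    ext j
    simp only [hx, hmem, hST]
  simpa [two_mul] using h

theorem BestResp_nonempty {n m : ℕ} (hn : 1 ≤ n) (θ : AgentType n m) (t : Fin m → ℝ) :
    (BestResp θ t).Nonempty := by
  have : Nonempty (Fin n) := ⟨⟨0, hn⟩⟩
  exact Finite.exists_max (uA θ t)

/-- The principal's utility reaches `τ` iff some best response of the agent gives it `τ`. -/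
theorem le_uP_iff {n m : ℕ} (hn : 1 ≤ n) (r : Fin m → ℝ) (θ : AgentType n m) (t : Fin m → ℝ)
    (τ : ℝ) : τ ≤ uP r θ t ↔ ∃ i ∈ BestResp θ t, τ ≤ uPa r θ t i := by
  have hfin : (uPa r θ t '' BestResp θ t).Finite := (Set.toFinite _).image _
  constructor
  · intro h
    obtain ⟨i, hi, hi'⟩ := ((BestResp_nonempty hn θ t).image _).csSup_mem hfin
    exact ⟨i, hi, h.trans hi'.ge⟩
  · rintro ⟨i, hi, h⟩
    exact h.trans (le_csSup hfin.bddAbove ⟨i, hi, rfl⟩)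

theorem uA_linear {n m : ℕ} (r : Fin m → ℝ) (θ : AgentType n m) (α : ℝ) (i : Fin n) :
    uA θ (fun j => α * r j) i = α * (∑ j, θ.f i j * r j) - θ.c i := by
  simp only [uA, Finset.mul_sum, mul_left_comm]

theorem uPa_linear {n m : ℕ} (r : Fin m → ℝ) (θ : AgentType n m) (α : ℝ) (i : Fin n) :
    uPa r θ (fun j => α * r j) i = (1 - α) * ∑ j, θ.f i j * r j := by
  simp only [uPa, Finset.mul_sum]
  exact Finset.sum_congr rfl fun j _ => by ring

/-- The set of `α` for which action `i` is a best response to `α • r` that yields the principal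
at least `τ` is an interval. -/
theorem ordConnected_setOf_bestResp {n m : ℕ} (r : Fin m → ℝ) (θ : AgentType n m) (τ : ℝ)
    (i : Fin n) :
    {α : ℝ | i ∈ BestResp θ (fun j => α * r j) ∧
      τ ≤ uPa r θ (fun j => α * r j) i}.OrdConnected := by
  apply Convex.ordConnected
  simp only [BestResp, Set.mem_ofPred_eq, uA_linear, uPa_linear]
  rintro x ⟨hx, hx'⟩ y ⟨hy, hy'⟩ a b ha hb hab
  obtain rfl : b = 1 - a := by linarith
  simp only [smul_eq_mul, Set.mem_ofPred_eq]
  refine ⟨fun k => ?_, ?_⟩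
  · linarith [mul_le_mul_of_nonneg_left (hx k) ha, mul_le_mul_of_nonneg_left (hy k) hb]
  · linarith [mul_le_mul_of_nonneg_left hx' ha, mul_le_mul_of_nonneg_left hy' hb]

theorem exists_eq_min_of_mem_Leps {m : ℕ} {r : Fin m → ℝ} {ε : ℝ} (hε : 0 < ε) {t : Fin m → ℝ}
    (ht : t ∈ Leps r ε) : ∃ k : Fin (⌈1 / ε⌉₊ + 1), t = fun j => min (k * ε) 1 * r j := by
  obtain ⟨α, ⟨k, rfl, hk⟩ | rfl, rfl⟩ := ht
  · have hk' : (k : ℝ) ≤ ⌈1 / ε⌉₊ := ((le_div_iff₀ hε).2 hk).trans (Nat.le_ceil _)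
    refine ⟨⟨k, Nat.lt_succ_of_le (by exact_mod_cast hk')⟩, ?_⟩
    simp only [min_eq_left hk]
  · refine ⟨Fin.last _, ?_⟩
    rw [Fin.val_last, min_eq_right ((div_le_iff₀ hε).1 (Nat.le_ceil (1 / ε)))]

/-- A class all of whose contracts are parametrised by `K` shatters at most `log₂ (card K)`
types. -/
theorem Shatters.two_pow_le_card {n m d : ℕ} {r : Fin m → ℝ} {C : Set (Fin m → ℝ)}
    {Θ : Set (AgentType n m)} (h : Shatters r C Θ d) {K : Type*} [Fintype K]
    (g : K → Fin m → ℝ) (hg : ∀ t ∈ C, ∃ k, t = g k) : 2 ^ d ≤ Fintype.card K := by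
  obtain ⟨θ, -, τ, h⟩ := h
  choose t htC htS htS' using h
  choose k hk using fun S => hg (t S) (htC S)
  have hmem : ∀ S j, j ∈ S ↔ τ j ≤ uP r (θ j) (t S) := fun S j =>
    ⟨htS S j, fun hle => by_contra fun hj => (htS' S j hj).not_ge hle⟩
  have hinj : Function.Injective k := fun S T hST => by
    ext j
    rw [hmem, hmem, hk S, hk T, hST]
  simpa using Fintype.card_le_of_injective k hinj

/-- Any class of linear contracts shattering `d` types satisfies `2 ^ d ≤ 2 d n + 1`. -/
theorem Shatters.two_pow_le_of_linear {n m d : ℕ} (hn : 1 ≤ n) {r : Fin m → ℝ}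
    {C : Set (Fin m → ℝ)} {Θ : Set (AgentType n m)} (h : Shatters r C Θ d)
    (hC : ∀ t ∈ C, ∃ α : ℝ, t = fun j => α * r j) : 2 ^ d ≤ 2 * (d * n) + 1 := by
  obtain ⟨θ, -, τ, h⟩ := h
  choose t htC htS htS' using h
  choose α hα using fun S => hC (t S) (htC S)
  have hcard := two_pow_card_le_of_intervals_shatter
    (fun (j : Fin d) (i : Fin n) => {α : ℝ | i ∈ BestResp (θ j) (fun j => α * r j) ∧
      τ j ≤ uPa r (θ j) (fun j => α * r j) i})
    (fun j i => ordConnected_setOf_bestResp r (θ j) (τ j) i) α fun S j => by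
      simp only [Set.mem_ofPred_eq, ← hα S]
      rw [← le_uP_iff hn]
      exact ⟨htS S j, fun hle => by_contra fun hj => (htS' S j hj).not_ge hle⟩
  simpa using hcard

theorem sq_le_four_mul_two_pow (d : ℕ) : d ^ 2 ≤ 4 * 2 ^ d := by
  induction d with
  | zero => norm_num
  | succ d ih =>
    have := Nat.lt_two_pow_self (n := d)
    rcases lt_or_ge d 3 with hd | hd
    · interval_cases d <;> norm_num
    · rw [pow_succ 2 d]
      nlinarith

theorem two_pow_le_pow_six {d n : ℕ} (hn : 1 ≤ n) (h : 2 ^ d ≤ 2 * (d * n) + 1) :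
    2 ^ d ≤ (n + 1) ^ 6 := by
  rcases Nat.eq_zero_or_pos d with rfl | hd
  · exact Nat.one_le_pow _ _ (Nat.succ_pos n)
  have h1 : 2 ^ d ≤ 2 * d * (n + 1) := by nlinarith
  have h2 : 2 ^ d * 2 ^ d ≤ 2 ^ d * (16 * (n + 1) ^ 2) :=
    calc 2 ^ d * 2 ^ d ≤ (2 * d * (n + 1)) * (2 * d * (n + 1)) := Nat.mul_le_mul h1 h1
      _ = d ^ 2 * (4 * (n + 1) ^ 2) := by ring
      _ ≤ 4 * 2 ^ d * (4 * (n + 1) ^ 2) := Nat.mul_le_mul_right _ (sq_le_four_mul_two_pow d)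
      _ = 2 ^ d * (16 * (n + 1) ^ 2) := by ring
  calc 2 ^ d ≤ 16 * (n + 1) ^ 2 := Nat.le_of_mul_le_mul_left h2 (by positivity)
    _ = 2 ^ 4 * (n + 1) ^ 2 := by norm_num
    _ ≤ (n + 1) ^ 4 * (n + 1) ^ 2 :=
      Nat.mul_le_mul_right _ (Nat.pow_le_pow_left (by omega) 4)
    _ = (n + 1) ^ 6 := by ring

theorem cast_le_logb_of_two_pow_le {d N : ℕ} (h : 2 ^ d ≤ N) : (d : ℝ) ≤ Real.logb 2 N := by
  have hN : (0 : ℝ) < N := by exact_mod_cast (Nat.two_pow_pos d).trans_le h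
  rw [Real.le_logb_iff_rpow_le (by norm_num) hN, Real.rpow_natCast]
  exact_mod_cast h

/-- There is an absolute constant `A > 0` so that for `0 < ε ≤ 1`, the
pseudo-dimension of the class `L_ε` of `ε`-discrete linear contracts is at most
`min( log₂(⌈1/ε⌉ + 1), A·log₂(n+1) )`. -/
theorem stmt_3 : ∃ A : ℝ, 0 < A ∧
    ∀ (n m : ℕ), 1 ≤ n → 2 ≤ m → ∀ r : Fin m → ℝ,
      (∀ j, 0 ≤ r j) → (∀ j : Fin m, (j : ℕ) = 0 → r j = 0) →
      ∀ ε : ℝ, 0 < ε → ε ≤ 1 →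
        ∀ d : ℕ, Shatters r (Leps r ε) (Set.univ : Set (AgentType n m)) d →
          (d : ℝ) ≤ min (Real.logb 2 ((⌈1/ε⌉₊ : ℝ) + 1)) (A * Real.logb 2 ((n : ℝ) + 1)) := by
  refine ⟨6, by norm_num, fun n m hn _ r _ _ ε hε _ d h => le_min ?_ ?_⟩
  · have hcard := h.two_pow_le_card (K := Fin (⌈1 / ε⌉₊ + 1))
      (fun k j => min (k * ε) 1 * r j) fun t ht => exists_eq_min_of_mem_Leps hε ht
    rw [Fintype.card_fin] at hcard
    exact_mod_cast cast_le_logb_of_two_pow_le hcard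
  · have hlin : 2 ^ d ≤ 2 * (d * n) + 1 := h.two_pow_le_of_linear hn fun t ht => by
      obtain ⟨α, -, rfl⟩ := ht
      exact ⟨α, rfl⟩
    have hlog := cast_le_logb_of_two_pow_le (two_pow_le_pow_six hn hlin)
    push_cast at hlog
    rwa [Real.logb_pow] at hlog
end

section
/- Assume n ≥ 2, m ≥ 2, r_0 = 0 and r_j ≥ 1 for all j ∈ {1,…,m−1}. Fix α_1,…,α_{m−1} ∈ [0,1] and 0 < ε < min_{1≤j≤m−1}(r_j − α_j). If a class C ⊆ C_bounded is an (ε/m)-approximation of C_bounded, then there exists a contract t ∈ C with t_0 ∈ [0, ε] and t_j ∈ [α_j, α_j + ε] for every j ∈ {1,…,m−1}. -/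
open scoped BigOperators

/-- The pushforward of a weight function on a finite index type along `x`. -/
noncomputable def FinDist.ofWeights {ι β : Type*} [Fintype ι] [DecidableEq β] (x : ι → β)
    (w : ι → ℝ) (hw : ∀ i, 0 ≤ w i) (hsum : ∑ i, w i = 1) : FinDist β where
  p a := ∑ i, if x i = a then w i else 0
  nonneg a := Finset.sum_nonneg fun i _ => by split_ifs <;> simp [hw]
  finite_support := by
    refine (Finset.univ.image x).finite_toSet.subset fun a ha => ?_
    obtain ⟨i, -, hi⟩ := Finset.exists_ne_zero_of_sum_ne_zero (Function.mem_support.1 ha)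
    have hxi : x i = a := by by_contra h; simp [h] at hi
    simp [← hxi]
  total := by
    rw [finsum_eq_sum_of_support_subset (s := Finset.univ.image x), Finset.sum_comm]
    · simp [hsum]
    · intro a ha
      obtain ⟨i, -, hi⟩ := Finset.exists_ne_zero_of_sum_ne_zero (Function.mem_support.1 ha)
      have hxi : x i = a := by by_contra h; simp [h] at hi
      simp [← hxi]

theorem expect_ofWeights {ι β : Type*} [Fintype ι] [DecidableEq β] (x : ι → β)
    (w : ι → ℝ) (hw : ∀ i, 0 ≤ w i) (hsum : ∑ i, w i = 1) (g : β → ℝ) :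
    expect (FinDist.ofWeights x w hw hsum) g = ∑ i, w i * g (x i) := by
  unfold expect
  rw [finsum_eq_sum_of_support_subset (s := Finset.univ.image x)]
  · simp only [FinDist.ofWeights, Finset.sum_mul]
    rw [Finset.sum_comm]
    simp [ite_mul]
  · intro a ha
    have hp : (∑ i, if x i = a then w i else 0) ≠ 0 := left_ne_zero_of_mul ha
    obtain ⟨i, -, hi⟩ := Finset.exists_ne_zero_of_sum_ne_zero hp
    have hxi : x i = a := by by_contra h; simp [h] at hi
    simp [← hxi]

theorem bestResp_nonempty {n m : ℕ} (hn : 0 < n) (θ : AgentType n m) (t : Fin m → ℝ) :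
    (BestResp θ t).Nonempty := by
  have : Nonempty (Fin n) := ⟨⟨0, hn⟩⟩
  exact Finite.exists_max (uA θ t)

theorem uP_le {n m : ℕ} (hn : 0 < n) {r : Fin m → ℝ} {θ : AgentType n m} {t : Fin m → ℝ} {B : ℝ}
    (h : ∀ i ∈ BestResp θ t, uPa r θ t i ≤ B) : uP r θ t ≤ B :=
  csSup_le ((bestResp_nonempty hn θ t).image _) (Set.forall_mem_image.2 h)

theorem le_uP {n m : ℕ} (r : Fin m → ℝ) {θ : AgentType n m} {t : Fin m → ℝ} {i : Fin n}
    (h : i ∈ BestResp θ t) : uPa r θ t i ≤ uP r θ t :=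
  le_csSup (Set.toFinite _).bddAbove (Set.mem_image_of_mem _ h)

/-- The type whose action `0` freely produces outcome `0`, and whose other actions produce
outcome `j` at cost `a`. -/
noncomputable def singleOutcomeType (n : ℕ) {k : ℕ} (j : Fin (k + 1)) (a : ℝ) (ha : 0 ≤ a) :
    AgentType n (k + 1) where
  f i := Pi.single (if (i : ℕ) = 0 then 0 else j) 1
  c i := if (i : ℕ) = 0 then 0 else a
  f_nonneg i l := by
    by_cases h : l = if (i : ℕ) = 0 then 0 else j
    · rw [h, Pi.single_eq_same]; exact zero_le_one
    · rw [Pi.single_eq_of_ne h]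
  f_sum i := by simp
  c_nonneg i := by split_ifs <;> simp [ha]
  c_zero i h := by simp [h]

section SingleOutcome

variable {n k : ℕ} {j : Fin (k + 1)} {a : ℝ} {ha : 0 ≤ a} {r t : Fin (k + 1) → ℝ} {i : Fin n}

theorem uA_singleOutcomeType_of_eq (hi : (i : ℕ) = 0) :
    uA (singleOutcomeType n j a ha) t i = t 0 := by
  simp [uA, singleOutcomeType, hi, Pi.single_apply]

theorem uA_singleOutcomeType_of_ne (hi : (i : ℕ) ≠ 0) :
    uA (singleOutcomeType n j a ha) t i = t j - a := by
  simp [uA, singleOutcomeType, hi, Pi.single_apply]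

theorem uPa_singleOutcomeType_of_eq (hi : (i : ℕ) = 0) :
    uPa r (singleOutcomeType n j a ha) t i = r 0 - t 0 := by
  simp [uPa, singleOutcomeType, hi, Pi.single_apply]

theorem uPa_singleOutcomeType_of_ne (hi : (i : ℕ) ≠ 0) :
    uPa r (singleOutcomeType n j a ha) t i = r j - t j := by
  simp [uPa, singleOutcomeType, hi, Pi.single_apply]

theorem add_le_of_mem_bestResp_singleOutcomeType
    (hi : i ∈ BestResp (singleOutcomeType n j a ha) t) (hi0 : (i : ℕ) ≠ 0) : a + t 0 ≤ t j := by
  have h := hi ⟨0, i.pos⟩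
  rw [uA_singleOutcomeType_of_eq rfl, uA_singleOutcomeType_of_ne hi0] at h
  linarith

theorem uP_singleOutcomeType_le (hn : 0 < n) (ht : 0 ≤ t 0) (hr0 : r 0 = 0) (har : a ≤ r j) :
    uP r (singleOutcomeType n j a ha) t ≤ r j - a := by
  refine uP_le hn fun i hi => ?_
  by_cases hi0 : (i : ℕ) = 0
  · rw [uPa_singleOutcomeType_of_eq hi0]
    linarith
  · rw [uPa_singleOutcomeType_of_ne hi0]
    linarith [add_le_of_mem_bestResp_singleOutcomeType hi hi0]

theorem le_uP_singleOutcomeType (hn : 2 ≤ n) (ht0 : t 0 = 0) (htj : t j = a) :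
    r j - a ≤ uP r (singleOutcomeType n j a ha) t := by
  have h1 : ((⟨1, hn⟩ : Fin n) : ℕ) ≠ 0 := one_ne_zero
  have hmem : (⟨1, hn⟩ : Fin n) ∈ BestResp (singleOutcomeType n j a ha) t := by
    intro i
    rw [uA_singleOutcomeType_of_ne h1]
    by_cases hi0 : (i : ℕ) = 0
    · rw [uA_singleOutcomeType_of_eq hi0]
      linarith
    · rw [uA_singleOutcomeType_of_ne hi0]
  refine le_trans ?_ (le_uP r hmem)
  rw [uPa_singleOutcomeType_of_ne h1, htj]

theorem bounds_of_lt_uP_singleOutcomeType (hn : 0 < n) {ε : ℝ} (ht : 0 ≤ t 0) (hr0 : r 0 = 0)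
    (hε : ε ≤ r j - a) (h : r j - a - ε < uP r (singleOutcomeType n j a ha) t) :
    a + t 0 ≤ t j ∧ t j ≤ a + ε := by
  obtain ⟨i, hi, hlt⟩ : ∃ i ∈ BestResp (singleOutcomeType n j a ha) t,
      r j - a - ε < uPa r (singleOutcomeType n j a ha) t i := by
    by_contra! hle
    exact absurd h (uP_le hn hle).not_gt
  by_cases hi0 : (i : ℕ) = 0
  · rw [uPa_singleOutcomeType_of_eq hi0] at hlt
    linarith
  · rw [uPa_singleOutcomeType_of_ne hi0] at hlt
    exact ⟨add_le_of_mem_bestResp_singleOutcomeType hi hi0, by linarith⟩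

end SingleOutcome

/-- With `r 0 = 0` and `r j ≥ 1` for `j ≠ 0`, fixing `α_j ∈ [0,1]` for
`j ≠ 0` and `0 < ε < min_{j≠0} (r j − α j)`, every `(ε/m)`-approximation `C ⊆ C_bounded`
of `C_bounded` contains a contract `t` with `t 0 ∈ [0, ε]` and `t j ∈ [α j, α j + ε]`
for all `j ≠ 0`. -/
theorem stmt_6 (n m : ℕ) (hn : 2 ≤ n) (hm : 2 ≤ m) (r : Fin m → ℝ)
    (hr : ∀ j, 0 ≤ r j) (hr0 : ∀ j : Fin m, (j : ℕ) = 0 → r j = 0)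
    (hr1 : ∀ j : Fin m, (j : ℕ) ≠ 0 → 1 ≤ r j)
    (α : Fin m → ℝ) (hα : ∀ j : Fin m, (j : ℕ) ≠ 0 → α j ∈ Set.Icc (0:ℝ) 1)
    (ε : ℝ) (hε0 : 0 < ε) (hε : ∀ j : Fin m, (j : ℕ) ≠ 0 → ε < r j - α j)
    (C : Set (Fin m → ℝ)) (hC : C ⊆ Cbounded m)
    (happrox : IsApprox n r C (Cbounded m) (ε / m)) :
    ∃ t ∈ C, t ⟨0, by omega⟩ ∈ Set.Icc (0:ℝ) ε ∧
      ∀ j : Fin m, (j : ℕ) ≠ 0 → t j ∈ Set.Icc (α j) (α j + ε) := by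
  classical
  obtain ⟨k, rfl⟩ : ∃ k, m = k + 1 := ⟨m - 1, by omega⟩
  have hk : 0 < k := by omega
  have : Nonempty (Fin k) := ⟨⟨0, hk⟩⟩
  have hkR : (0 : ℝ) < k := by exact_mod_cast hk
  have hs : ∀ j : Fin k, ((j.succ : Fin (k + 1)) : ℕ) ≠ 0 := fun j => by simp
  have hr00 : r 0 = 0 := hr0 0 rfl
  set D : FinDist (AgentType n (k + 1)) := FinDist.ofWeights
    (fun j : Fin k => singleOutcomeType n j.succ (α j.succ) (hα _ (hs j)).1)
    (fun _ => (k : ℝ)⁻¹) (fun _ => by positivity) (by simp [hkR.ne'])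
  have hexp (g : AgentType n (k + 1) → ℝ) : expect D g =
      ∑ j : Fin k, (k : ℝ)⁻¹ * g (singleOutcomeType n j.succ (α j.succ) (hα _ (hs j)).1) :=
    expect_ofWeights _ _ _ _ g
  have hup (t : Fin (k + 1) → ℝ) (ht : t ∈ Cbounded (k + 1)) (j : Fin k) :
      uP r (singleOutcomeType n j.succ (α j.succ) (hα _ (hs j)).1) t ≤ r j.succ - α j.succ :=
    uP_singleOutcomeType_le (by omega) (ht 0).1 hr00 (by linarith [hε _ (hs j)])
  set V : ℝ := ∑ j : Fin k, (k : ℝ)⁻¹ * (r j.succ - α j.succ) with hV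
  have hεV : ε < V := by
    calc ε = ∑ _j : Fin k, (k : ℝ)⁻¹ * ε := by simp [hkR.ne']
      _ < V := Finset.sum_lt_sum_of_nonempty Finset.univ_nonempty fun j _ =>
        mul_lt_mul_of_pos_left (hε _ (hs j)) (by positivity)
  have hOPT : V ≤ OPT (Cbounded (k + 1)) r D := by
    have hmem : (Fin.cons 0 fun j : Fin k => α j.succ : Fin (k + 1) → ℝ) ∈ Cbounded (k + 1) := by
      intro j
      refine Fin.cases ?_ (fun j => ?_) j
      · simp
      · simpa using hα _ (hs j)
    refine le_csSup_of_le ⟨V, ?_⟩ (Set.mem_image_of_mem _ hmem) ?_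
    · rintro _ ⟨t, ht, rfl⟩
      simp only [hexp]
      exact Finset.sum_le_sum fun j _ => mul_le_mul_of_nonneg_left (hup t ht j) (by positivity)
    · simp only [hexp]
      exact Finset.sum_le_sum fun j _ => mul_le_mul_of_nonneg_left
        (le_uP_singleOutcomeType hn (by simp) (by simp)) (by positivity)
  have hlt : ε / ((k + 1 : ℕ) : ℝ) < (k : ℝ)⁻¹ * ε := by
    rw [← div_eq_inv_mul]
    exact div_lt_div_of_pos_left hε0 hkR (by push_cast; linarith)
  have hle : ε / ((k + 1 : ℕ) : ℝ) ≤ ε :=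
    div_le_self hε0.le (by push_cast; linarith)
  have hC' := happrox D
  have hne : C.Nonempty := by
    by_contra hC0
    rw [Set.not_nonempty_iff_eq_empty] at hC0
    have h0 : OPT C r D = 0 := by simp [OPT, hC0]
    linarith
  obtain ⟨_, ⟨t, htC, rfl⟩, htV⟩ := exists_lt_of_lt_csSup (hne.image _)
    (show V - (k : ℝ)⁻¹ * ε < OPT C r D by linarith)
  have ht := hC htC
  have hb (j : Fin k) : α j.succ + t 0 ≤ t j.succ ∧ t j.succ ≤ α j.succ + ε := by
    refine bounds_of_lt_uP_singleOutcomeType (n := n) (ha := (hα _ (hs j)).1) (by omega) (ht 0).1 hr00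
      (hε _ (hs j)).le ?_
    simp only [hexp] at htV
    have hsingle := Finset.single_le_sum (s := Finset.univ)
      (f := fun j : Fin k => (k : ℝ)⁻¹ * (r j.succ - α j.succ) - (k : ℝ)⁻¹ *
        uP r (singleOutcomeType n j.succ (α j.succ) (hα _ (hs j)).1) t)
      (fun j _ => sub_nonneg.2 (mul_le_mul_of_nonneg_left (hup t ht j) (by positivity)))
      (Finset.mem_univ j)
    rw [Finset.sum_sub_distrib, ← hV] at hsingle
    have hlt' := lt_of_mul_lt_mul_left (a := (k : ℝ)⁻¹)
      (b := r j.succ - α j.succ -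
        uP r (singleOutcomeType n j.succ (α j.succ) (hα _ (hs j)).1) t) (c := ε)
      (by linarith) (by positivity)
    linarith
  refine ⟨t, htC, ⟨(ht 0).1, ?_⟩, fun j hj => ?_⟩
  · have h := hb ⟨0, hk⟩
    change t 0 ≤ ε
    linarith
  · obtain ⟨i, rfl⟩ := Fin.exists_succ_eq.2 (fun h : j = 0 => hj (by simp [h]))
    exact ⟨by linarith [(hb i).1, (ht 0).1], (hb i).2⟩
end
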